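/- Let d ≥ 1, let μ be the Haar probability measure on U(d), let ν be any Borel probability measure on U(d), and let ρ be a pure-state density matrix (positive semidefinite, Tr[ρ] = 1, ρ² = ρ). With A(ρ) := ∫ V ρ V† dμ(V) − ∫ U ρ U† dν(U), the squared Frobenius norm of the expressivity operator satisfies ‖A(ρ)‖₂² = ∫∫ Tr[(U ρ U†)(V ρ V†)] dν(U) dν(V) − 1/d. (The double integral is the average squared state overlap μ(ρ) = E[ |⟨ψ_θ|ψ_φ⟩|² ] of the ensemble, so ‖A(ρ)‖₂ = √(μ(ρ) − 1/d).) -/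

import Mathlib

open MeasureTheory Matrix
open scoped Kronecker ComplexOrder

noncomputable section

attribute [local instance] Matrix.frobeniusNormedAddCommGroup Matrix.frobeniusNormedSpace

local instance {n m : Type*} [Fintype n] [Fintype m] : MeasurableSpace (Matrix n m ℂ) :=
  borel _

local instance {n m : Type*} [Fintype n] [Fintype m] : BorelSpace (Matrix n m ℂ) := ⟨rfl⟩

/-- The Frobenius (Hilbert–Schmidt) norm `‖M‖₂ = √Tr[M† M]`. -/
def frobNorm {n : Type*} [Fintype n] (M : Matrix n n ℂ) : ℝ :=
  Real.sqrt (Matrix.trace (star M * M)).re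


section
open scoped Matrix.Norms.L2Operator
theorem span_uni (d : ℕ) : Submodule.span ℂ (unitary (Matrix (Fin d) (Fin d) ℂ) : Set (Matrix (Fin d) (Fin d) ℂ)) = ⊤ :=
  CStarAlgebra.span_unitary _
end

theorem gen_lin {G E : Type*} [TopologicalSpace G] [CompactSpace G] [MeasurableSpace G]
    [OpensMeasurableSpace G] [NormedAddCommGroup E] [NormedSpace ℂ E] [FiniteDimensional ℂ E]
    (ν : Measure G) [IsFiniteMeasure ν] (f : G → E) (hf : Continuous f) (L : E →ₗ[ℂ] ℂ) :
    L (∫ x, f x ∂ν) = ∫ x, L (f x) ∂ν := by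
  have hi : Integrable f ν := hf.integrable_of_hasCompactSupport (HasCompactSupport.of_compactSpace f)
  have : CompleteSpace E := FiniteDimensional.complete ℂ E
  exact ((LinearMap.toContinuousLinearMap L).integral_comp_comm hi).symm

theorem cont_f {d : ℕ} (ρ : Matrix (Fin d) (Fin d) ℂ) :
    Continuous (fun V : Matrix.unitaryGroup (Fin d) ℂ => V.1 * ρ * star V.1) := by
  fun_prop

theorem compact_unitary (d : ℕ) : CompactSpace (Matrix.unitaryGroup (Fin d) ℂ) := by
  refine (isCompact_iff_compactSpace
    (s := (Matrix.unitaryGroup (Fin d) ℂ : Set (Matrix (Fin d) (Fin d) ℂ)))).1 ?_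
  have hK : IsCompact (Set.pi Set.univ fun _ : Fin d => Set.pi Set.univ fun _ : Fin d =>
      Metric.closedBall (0 : ℂ) 1) :=
    isCompact_univ_pi fun _ => isCompact_univ_pi fun _ => isCompact_closedBall _ _
  refine IsCompact.of_isClosed_subset (X := Matrix (Fin d) (Fin d) ℂ) hK ?_ ?_
  · have : (Matrix.unitaryGroup (Fin d) ℂ : Set (Matrix (Fin d) (Fin d) ℂ)) =
      {U | star U * U = 1 ∧ U * star U = 1} := by
      ext U; simp [Matrix.unitaryGroup, Unitary.mem_iff]
    rw [this]
    exact (isClosed_eq (by fun_prop) (by fun_prop)).inter (isClosed_eq (by fun_prop) (by fun_prop))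
  · intro U hU
    intro i _ j _
    exact mem_closedBall_zero_iff.2 (entry_norm_bound_of_unitary hU i j)

theorem lin_f {d : ℕ} (ν : Measure (Matrix.unitaryGroup (Fin d) ℂ)) [IsProbabilityMeasure ν]
    (ρ : Matrix (Fin d) (Fin d) ℂ) (L : Matrix (Fin d) (Fin d) ℂ →ₗ[ℂ] ℂ) :
    L (∫ V : Matrix.unitaryGroup (Fin d) ℂ, V.1 * ρ * star V.1 ∂ν)
      = ∫ V : Matrix.unitaryGroup (Fin d) ℂ, L (V.1 * ρ * star V.1) ∂ν := by
  have := compact_unitary d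
  exact gen_lin ν (fun V : Matrix.unitaryGroup (Fin d) ℂ => V.1 * ρ * star V.1) (cont_f ρ) L

theorem tr_f {d : ℕ} (ν : Measure (Matrix.unitaryGroup (Fin d) ℂ)) [IsProbabilityMeasure ν]
    (ρ : Matrix (Fin d) (Fin d) ℂ) (h : ρ.trace = 1) :
    (∫ V : Matrix.unitaryGroup (Fin d) ℂ, V.1 * ρ * star V.1 ∂ν).trace = 1 := by
  have := lin_f ν ρ (Matrix.traceLinearMap (Fin d) ℂ ℂ)
  simp only [Matrix.traceLinearMap_apply] at this
  rw [this]
  have h2 : ∀ V : Matrix.unitaryGroup (Fin d) ℂ, (V.1 * ρ * star V.1).trace = 1 := by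
    intro V
    rw [Matrix.trace_mul_cycle, Unitary.star_mul_self_of_mem V.2, one_mul, h]
  simp [h2]

theorem herm_f {d : ℕ} (ν : Measure (Matrix.unitaryGroup (Fin d) ℂ)) [IsProbabilityMeasure ν]
    (ρ : Matrix (Fin d) (Fin d) ℂ) (h : star ρ = ρ) :
    star (∫ V : Matrix.unitaryGroup (Fin d) ℂ, V.1 * ρ * star V.1 ∂ν) =
     ∫ V : Matrix.unitaryGroup (Fin d) ℂ, V.1 * ρ * star V.1 ∂ν := by
  ext i j
  have h1 := lin_f ν ρ (Matrix.entryLinearMap ℂ ℂ i j)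
  have h2 := lin_f ν ρ (Matrix.entryLinearMap ℂ ℂ j i)
  simp only [Matrix.entryLinearMap_apply] at h1 h2
  rw [Matrix.star_apply, h1, h2]
  have := integral_conj (𝕜 := ℂ) (μ := ν)
    (f := fun V : Matrix.unitaryGroup (Fin d) ℂ => (V.1 * ρ * star V.1) j i)
  rw [← starRingEnd_apply, ← this]
  congr 1
  ext V
  have h3 : star (V.1 * ρ * star V.1) = V.1 * ρ * star V.1 := by
    simp [h, mul_assoc]
  conv_rhs => rw [← h3]
  rfl

theorem inv_f {d : ℕ} (μ : Measure (Matrix.unitaryGroup (Fin d) ℂ)) [μ.IsHaarMeasure]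
    [IsProbabilityMeasure μ]
    (ρ : Matrix (Fin d) (Fin d) ℂ) (W : Matrix.unitaryGroup (Fin d) ℂ) :
    W.1 * (∫ V : Matrix.unitaryGroup (Fin d) ℂ, V.1 * ρ * star V.1 ∂μ) * star W.1 =
     ∫ V : Matrix.unitaryGroup (Fin d) ℂ, V.1 * ρ * star V.1 ∂μ := by
  ext i j
  have h1 := lin_f μ ρ (Matrix.entryLinearMap ℂ ℂ i j)
  have h2 := lin_f μ ρ (Matrix.entryLinearMap ℂ ℂ i j ∘ₗ LinearMap.mulRight ℂ (star W.1)
    ∘ₗ LinearMap.mulLeft ℂ W.1)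
  simp only [LinearMap.comp_apply, Matrix.entryLinearMap_apply, LinearMap.mulRight_apply,
    LinearMap.mulLeft_apply] at h1 h2
  rw [h1, h2]
  refine Eq.trans ?_ (integral_mul_left_eq_self
    (fun V : Matrix.unitaryGroup (Fin d) ℂ => (V.1 * ρ * star V.1) i j) W)
  simp [mul_assoc]

theorem scalar_f {d : ℕ} (hd : 1 ≤ d) (μ : Measure (Matrix.unitaryGroup (Fin d) ℂ))
    [μ.IsHaarMeasure] [IsProbabilityMeasure μ]
    (ρ : Matrix (Fin d) (Fin d) ℂ) (h : ρ.trace = 1) :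
    (∫ V : Matrix.unitaryGroup (Fin d) ℂ, V.1 * ρ * star V.1 ∂μ) = (1 / (d : ℂ)) • 1 := by
  have h0 := tr_f μ ρ h
  have h1 := inv_f μ ρ
  generalize (∫ V : Matrix.unitaryGroup (Fin d) ℂ, V.1 * ρ * star V.1 ∂μ) = M at h0 h1
  have h2 : ∀ X : Matrix (Fin d) (Fin d) ℂ, X * M = M * X := by
    intro X
    have hX : X ∈ Submodule.span ℂ
      (unitary (Matrix (Fin d) (Fin d) ℂ) : Set (Matrix (Fin d) (Fin d) ℂ)) := by
      rw [span_uni]; trivial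
    induction hX using Submodule.span_induction with
    | mem x hx =>
      have := h1 ⟨x, hx⟩
      conv_rhs => rw [← this]
      simp [mul_assoc, Unitary.star_mul_self_of_mem hx]
    | zero => simp
    | add x y _ _ hx hy => rw [add_mul, mul_add, hx, hy]
    | smul a x _ hx => simp [hx]
  obtain ⟨c, hc⟩ : M ∈ Set.range (Matrix.scalar (Fin d)) := by
    rw [Matrix.mem_range_scalar_iff_commute_single']
    intro i j
    exact h2 _
  have hc' : M = c • (1 : Matrix (Fin d) (Fin d) ℂ) := by
    rw [← hc]; simp [Matrix.smul_one_eq_diagonal]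
  have hd' : (d : ℂ) ≠ 0 := by
    exact_mod_cast (by omega : d ≠ 0)
  rw [hc'] at h0 ⊢
  simp at h0
  congr 1
  field_simp
  exact h0

theorem frobNorm_sq {n : Type*} [Fintype n] (M : Matrix n n ℂ) :
    ((frobNorm M ^ 2 : ℝ) : ℂ) = (star M * M).trace := by
  have h : 0 ≤ (star M * M).trace := (Matrix.posSemidef_conjTranspose_mul_self M).trace_nonneg
  obtain ⟨h1, h2⟩ := Complex.nonneg_iff.1 h
  unfold frobNorm
  rw [Real.sq_sqrt h1]
  exact Complex.ext (by simp) (by simp [← h2])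

/-- The squared Frobenius norm of the expressivity operator equals the average squared
state overlap of the ensemble minus `1/d`:
`‖A(ρ)‖₂² = ∫∫ Tr[(U ρ U†)(V ρ V†)] dν(U) dν(V) − 1/d`. -/
theorem frobNorm_sq_expressivity (d : ℕ) (hd : 1 ≤ d)
    (μ ν : Measure (Matrix.unitaryGroup (Fin d) ℂ))
    [μ.IsHaarMeasure] [IsProbabilityMeasure μ] [IsProbabilityMeasure ν]
    (ρ : Matrix (Fin d) (Fin d) ℂ) (hρ : ρ.PosSemidef)
    (hρ1 : ρ.trace = 1) (hρ2 : ρ * ρ = ρ)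
    (Aρ : Matrix (Fin d) (Fin d) ℂ)
    (hAρ : Aρ = (∫ V : Matrix.unitaryGroup (Fin d) ℂ, V.1 * ρ * star V.1 ∂μ)
              - ∫ U : Matrix.unitaryGroup (Fin d) ℂ, U.1 * ρ * star U.1 ∂ν) :
    ((frobNorm Aρ ^ 2 : ℝ) : ℂ)
      = (∫ U : Matrix.unitaryGroup (Fin d) ℂ,
            ∫ V : Matrix.unitaryGroup (Fin d) ℂ,
              ((U.1 * ρ * star U.1) * (V.1 * ρ * star V.1)).trace ∂ν ∂ν)
        - 1 / (d : ℂ) := by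
  have hN1 := tr_f ν ρ hρ1
  have hN2 := herm_f ν ρ hρ.1
  have hd' : (d : ℂ) ≠ 0 := by
    exact_mod_cast (by omega : d ≠ 0)
  have hI : (∫ U : Matrix.unitaryGroup (Fin d) ℂ,
            ∫ V : Matrix.unitaryGroup (Fin d) ℂ,
              ((U.1 * ρ * star U.1) * (V.1 * ρ * star V.1)).trace ∂ν ∂ν)
      = ((∫ U : Matrix.unitaryGroup (Fin d) ℂ, U.1 * ρ * star U.1 ∂ν) *
        (∫ U : Matrix.unitaryGroup (Fin d) ℂ, U.1 * ρ * star U.1 ∂ν)).trace := by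
    have h1 : ∀ X : Matrix (Fin d) (Fin d) ℂ,
        ∫ V : Matrix.unitaryGroup (Fin d) ℂ, (X * (V.1 * ρ * star V.1)).trace ∂ν
        = (X * ∫ V : Matrix.unitaryGroup (Fin d) ℂ, V.1 * ρ * star V.1 ∂ν).trace := fun X =>
      (lin_f ν ρ (Matrix.traceLinearMap (Fin d) ℂ ℂ ∘ₗ LinearMap.mulLeft ℂ X)).symm
    simp only [h1]
    exact (lin_f ν ρ (Matrix.traceLinearMap (Fin d) ℂ ℂ ∘ₗ LinearMap.mulRight ℂ _)).symm
  rw [frobNorm_sq, hI, hAρ, scalar_f hd μ ρ hρ1]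
  generalize (∫ U : Matrix.unitaryGroup (Fin d) ℂ, U.1 * ρ * star U.1 ∂ν) = N at hN1 hN2
  rw [star_sub, hN2]
  have : star ((1 / (d : ℂ)) • (1 : Matrix (Fin d) (Fin d) ℂ)) = (1 / (d : ℂ)) • 1 := by
    simp [star_smul]
  rw [this]
  simp only [sub_mul, mul_sub, Matrix.trace_sub, smul_mul_assoc, mul_smul_comm, one_mul, mul_one,
    Matrix.trace_smul, hN1, Matrix.trace_one, Fintype.card_fin, smul_eq_mul]
  field_simp
  ring
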